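/- Let d ≥ 3 be an odd integer, r ∈ F_q^*, and m, m' ∈ F_q^d. Then Σ_{t ∈ F_q} Ŝ_t(m)·Ŝ_{rt}(m') equals q^{−1}·δ_0(m)·δ_0(m') + (q^{−d} − q^{−d−1})·η(r) if ||m|| = r·||m'||, and equals −q^{−d−1}·η(r) if ||m|| ≠ r·||m'||. Here δ_0(m) = 1 if m is the zero vector and 0 otherwise. -/

import Mathlib

open Finset

def nrm {F : Type} [Field F] {d : ℕ} (x : Fin d → F) : F := ∑ i, x i ^ 2

noncomputable def ft {F : Type} [Field F] [Fintype F] (d : ℕ) (χ : AddChar F ℂ)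
    (f : (Fin d → F) → ℂ) (m : Fin d → F) : ℂ :=
  (Fintype.card F : ℂ) ^ (-(d : ℤ)) * ∑ x : Fin d → F, χ (-(∑ i, x i * m i)) * f x

noncomputable def sphereFT {F : Type} [Field F] [Fintype F] [DecidableEq F] (d : ℕ)
    (χ : AddChar F ℂ) (t : F) (m : Fin d → F) : ℂ :=
  ft d χ (fun x => if nrm x = t then 1 else 0) m

noncomputable def eta (F : Type) [Field F] [Fintype F] [DecidableEq F] (s : F) : ℂ :=
  ((quadraticChar F s : ℤ) : ℂ)

noncomputable def gSum (F : Type) [Field F] [Fintype F] [DecidableEq F] (χ : AddChar F ℂ) : ℂ :=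
  ∑ s ∈ Finset.univ.filter (fun s : F => s ≠ 0), eta F s * χ s

def nu {F : Type} [Field F] [Fintype F] [DecidableEq F] {d : ℕ}
    (E : Finset (Fin d → F)) (t : F) : ℕ :=
  ((E ×ˢ E).filter (fun p => nrm (p.1 - p.2) = t)).card

def distSet {F : Type} [Field F] {d : ℕ} (E : Finset (Fin d → F)) : Set F :=
  {t | ∃ x ∈ E, ∃ y ∈ E, nrm (x - y) = t}

def quotSet {F : Type} [Field F] {d : ℕ} (E : Finset (Fin d → F)) : Set F :=
  {r | ∃ a ∈ distSet E, ∃ b ∈ distSet E, b ≠ 0 ∧ r = a / b}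

def sphereCard (F : Type) [Field F] [Fintype F] [DecidableEq F] (d : ℕ) (t : F) : ℕ :=
  (Finset.univ.filter (fun x : Fin d → F => nrm x = t)).card

theorem AddChar.map_finset_sum {A M ι : Type*} [AddCommMonoid A] [CommMonoid M] (χ : AddChar A M)
    (s : Finset ι) (f : ι → A) : χ (∑ i ∈ s, f i) = ∏ i ∈ s, χ (f i) := by
  classical
  induction s using Finset.induction_on with
  | empty => simp
  | insert a s ha ih => rw [Finset.sum_insert ha, Finset.prod_insert ha, χ.map_add_eq_mul, ih]

theorem eta_eq_ringHomComp {F : Type} [Field F] [Fintype F] [DecidableEq F] (s : F) :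
    eta F s = (quadraticChar F).ringHomComp (Int.castRingHom ℂ) s := rfl

theorem eta_sq {F : Type} [Field F] [Fintype F] [DecidableEq F] {s : F} (hs : s ≠ 0) :
    eta F s ^ 2 = 1 := by
  have h := quadraticChar_sq_one hs
  unfold eta
  exact_mod_cast h

theorem eta_mul {F : Type} [Field F] [Fintype F] [DecidableEq F] (a b : F) :
    eta F (a * b) = eta F a * eta F b := by
  simp only [eta, map_mul, Int.cast_mul]

theorem sum_addChar_mul {F : Type} [Field F] [Fintype F] [DecidableEq F]
    {χ : AddChar F ℂ} (hχ : χ ≠ 1) (a : F) :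
    ∑ s : F, χ (s * a) = if a = 0 then (Fintype.card F : ℂ) else 0 := by
  have h := AddChar.sum_mulShift a (AddChar.IsPrimitive.of_ne_one hχ)
  rw [h]
  split_ifs <;> simp

theorem sum_addChar_mul_sq {F : Type} [Field F] [Fintype F] [DecidableEq F]
    (hF : ringChar F ≠ 2) {χ : AddChar F ℂ} (hχ : χ ≠ 1) {s : F} (hs : s ≠ 0) :
    ∑ x : F, χ (s * x ^ 2) = eta F s *
      gaussSum ((quadraticChar F).ringHomComp (Int.castRingHom ℂ)) χ := by
  have h1 : ∑ x : F, χ (s * x ^ 2) = ∑ u : F, (eta F u + 1) * χ (s * u) := by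
    rw [← Finset.sum_fiberwise (s := Finset.univ) (g := fun x : F => x ^ 2)]
    refine Finset.sum_congr rfl fun u _ => ?_
    rw [Finset.sum_congr rfl (g := fun _ => χ (s * u))
      (fun x hx => by rw [(Finset.mem_filter.mp hx).2]), Finset.sum_const, nsmul_eq_mul]
    congr 1
    have h := quadraticChar_card_sqrts hF u
    have h2 : ({x : F | x ^ 2 = u} : Set F).toFinset = Finset.univ.filter (fun x => x ^ 2 = u) := by
      ext; simp
    rw [h2] at h
    unfold eta
    exact_mod_cast h
  have h3 : ∑ u : F, χ (s * u) = 0 := by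
    have := sum_addChar_mul hχ s
    simpa [mul_comm, hs] using this
  have h4 := gaussSum_mulShift ((quadraticChar F).ringHomComp (Int.castRingHom ℂ)) χ
    (Units.mk0 s hs)
  rw [← h4, Units.val_mk0, ← eta_eq_ringHomComp, ← mul_assoc, ← sq, eta_sq hs, one_mul, h1]
  simp only [add_mul, one_mul, Finset.sum_add_distrib, h3, add_zero]
  rfl

theorem sum_addChar_quadratic {F : Type} [Field F] [Fintype F] [DecidableEq F]
    (hF : ringChar F ≠ 2) {χ : AddChar F ℂ} (hχ : χ ≠ 1) {s : F} (hs : s ≠ 0) (a : F) :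
    ∑ x : F, χ (s * x ^ 2 - x * a) = eta F s *
      gaussSum ((quadraticChar F).ringHomComp (Int.castRingHom ℂ)) χ * χ (-(a ^ 2 / (4 * s))) := by
  have h2 : (2 : F) ≠ 0 := Ring.two_ne_zero hF
  rw [← sum_addChar_mul_sq hF hχ hs, Finset.sum_mul,
    ← Equiv.sum_comp (Equiv.addRight (a / (2 * s)))]
  refine Finset.sum_congr rfl fun x _ => ?_
  rw [← AddChar.map_add_eq_mul]
  congr 1
  have h4 : (4 : F) = 2 * 2 := by norm_num
  simp only [Equiv.coe_addRight, h4]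
  field_simp
  ring

theorem sum_addChar_nrm {F : Type} [Field F] [Fintype F] [DecidableEq F]
    (hF : ringChar F ≠ 2) {χ : AddChar F ℂ} (hχ : χ ≠ 1) {d : ℕ} {s : F} (hs : s ≠ 0)
    (m : Fin d → F) :
    ∑ x : Fin d → F, χ (s * nrm x - ∑ i, x i * m i) = (eta F s *
      gaussSum ((quadraticChar F).ringHomComp (Int.castRingHom ℂ)) χ) ^ d *
        χ (-(nrm m / (4 * s))) := by
  have h : ∀ x : Fin d → F, χ (s * nrm x - ∑ i, x i * m i)
      = ∏ i, χ (s * x i ^ 2 - x i * m i) := fun x => by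
    rw [nrm, Finset.mul_sum, ← Finset.sum_sub_distrib, AddChar.map_finset_sum]
  simp only [h]
  rw [← Fintype.prod_sum (fun i (x : F) => χ (s * x ^ 2 - x * m i))]
  simp only [sum_addChar_quadratic hF hχ hs]
  rw [Finset.prod_mul_distrib, Finset.prod_const, ← AddChar.map_finset_sum, Finset.card_univ,
    Fintype.card_fin, nrm, Finset.sum_neg_distrib, Finset.sum_div]

theorem sum_addChar_dotProduct {F : Type} [Field F] [Fintype F] [DecidableEq F]
    {χ : AddChar F ℂ} (hχ : χ ≠ 1) {d : ℕ} (m : Fin d → F) :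
    ∑ x : Fin d → F, χ (-∑ i, x i * m i)
      = if m = 0 then (Fintype.card F : ℂ) ^ d else 0 := by
  have h : ∀ x : Fin d → F, χ (-∑ i, x i * m i) = ∏ i, χ (x i * -m i) := fun x => by
    rw [← Finset.sum_neg_distrib, AddChar.map_finset_sum]
    simp only [mul_neg]
  simp only [h]
  rw [← Fintype.prod_sum (fun i (x : F) => χ (x * -m i))]
  simp only [sum_addChar_mul hχ, neg_eq_zero]
  split_ifs with hm
  · simp [hm]
  · obtain ⟨i, hi⟩ := Function.ne_iff.mp hm
    exact Finset.prod_eq_zero (Finset.mem_univ i) (if_neg hi)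

theorem sum_sphereFT_mul {F : Type} [Field F] [Fintype F] [DecidableEq F] {d : ℕ}
    {χ : AddChar F ℂ} (hχ : χ ≠ 1) (r : F) (m m' : Fin d → F) :
    ∑ t : F, sphereFT d χ t m * sphereFT d χ (r * t) m'
      = (Fintype.card F : ℂ) ^ (-(d : ℤ)) * (Fintype.card F : ℂ) ^ (-(d : ℤ)) *
        (Fintype.card F : ℂ)⁻¹ * ∑ s : F,
          (∑ x : Fin d → F, χ (s * r * nrm x - ∑ i, x i * m i)) *
          ∑ y : Fin d → F, χ (-s * nrm y - ∑ i, y i * m' i) := by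
  have hq : (Fintype.card F : ℂ) ≠ 0 := by simp
  have hR : ∑ s : F, (∑ x : Fin d → F, χ (s * r * nrm x - ∑ i, x i * m i)) *
        (∑ y : Fin d → F, χ (-s * nrm y - ∑ i, y i * m' i))
      = Fintype.card F * ∑ x : Fin d → F, ∑ y : Fin d → F,
        χ (-∑ i, x i * m i) * χ (-∑ i, y i * m' i) * if nrm y = r * nrm x then 1 else 0 := by
    simp only [Finset.sum_mul_sum]
    simp only [Finset.mul_sum]
    rw [Finset.sum_comm]
    refine Finset.sum_congr rfl fun x _ => ?_
    rw [Finset.sum_comm]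
    refine Finset.sum_congr rfl fun y _ => ?_
    have h : ∀ s : F, χ (s * r * nrm x - ∑ i, x i * m i) * χ (-s * nrm y - ∑ i, y i * m' i)
        = χ (s * (r * nrm x - nrm y)) * (χ (-∑ i, x i * m i) * χ (-∑ i, y i * m' i)) := fun s => by
      simp only [← AddChar.map_add_eq_mul]
      congr 1
      ring
    simp only [h]
    rw [← Finset.sum_mul, sum_addChar_mul hχ]
    simp only [sub_eq_zero, eq_comm (a := nrm y)]
    split_ifs <;> ring
  have hL : ∑ t : F, sphereFT d χ t m * sphereFT d χ (r * t) m'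
      = (Fintype.card F : ℂ) ^ (-(d : ℤ)) * (Fintype.card F : ℂ) ^ (-(d : ℤ)) *
        ∑ x : Fin d → F, ∑ y : Fin d → F,
        χ (-∑ i, x i * m i) * χ (-∑ i, y i * m' i) * if nrm y = r * nrm x then 1 else 0 := by
    have h : ∀ t : F, sphereFT d χ t m * sphereFT d χ (r * t) m'
      = (Fintype.card F : ℂ) ^ (-(d : ℤ)) * (Fintype.card F : ℂ) ^ (-(d : ℤ)) *
        ∑ x : Fin d → F, ∑ y : Fin d → F, if nrm x = t then
        χ (-∑ i, x i * m i) * χ (-∑ i, y i * m' i) * (if nrm y = r * nrm x then 1 else 0)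
        else 0 := fun t => by
      rw [sphereFT, sphereFT, ft, ft, mul_mul_mul_comm, Finset.sum_mul_sum]
      congr 1
      refine Finset.sum_congr rfl fun x _ => Finset.sum_congr rfl fun y _ => ?_
      by_cases hx : nrm x = t
      · simp [hx]
      · simp [hx]
    simp only [h]
    rw [← Finset.mul_sum, Finset.sum_comm]
    congr 1
    refine Finset.sum_congr rfl fun x _ => ?_
    rw [Finset.sum_comm]
    refine Finset.sum_congr rfl fun y _ => ?_
    simp
  rw [hL, hR]
  field_simp

theorem sum_nrm_mul_sum_nrm {F : Type} [Field F] [Fintype F] [DecidableEq F]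
    (hF : ringChar F ≠ 2) {χ : AddChar F ℂ} (hχ : χ ≠ 1) {d : ℕ} (hd : Odd d)
    {r s : F} (hr : r ≠ 0) (hs : s ≠ 0) (m m' : Fin d → F) :
    (∑ x : Fin d → F, χ (s * r * nrm x - ∑ i, x i * m i)) *
        ∑ y : Fin d → F, χ (-s * nrm y - ∑ i, y i * m' i)
      = eta F r * (Fintype.card F : ℂ) ^ d * χ (s⁻¹ * ((r * nrm m' - nrm m) / (4 * r))) := by
  rw [sum_addChar_nrm hF hχ (mul_ne_zero hs hr), sum_addChar_nrm hF hχ (neg_ne_zero.mpr hs),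
    mul_mul_mul_comm, ← mul_pow, ← AddChar.map_add_eq_mul]
  have h2 : (2 : F) ≠ 0 := Ring.two_ne_zero hF
  have h4 : (4 : F) = 2 * 2 := by norm_num
  have hg := gaussSum_sq (χ := (quadraticChar F).ringHomComp (Int.castRingHom ℂ))
    ((MulChar.ringHomComp_ne_one_iff Int.cast_injective).mpr (quadraticChar_ne_one hF))
    ((quadraticChar_isQuadratic F).comp _) (AddChar.IsPrimitive.of_ne_one hχ)
  rw [← eta_eq_ringHomComp] at hg
  have hb : ∀ g : ℂ, g ^ 2 = eta F (-1) * Fintype.card F →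
      eta F (s * r) * g * (eta F (-s) * g) = eta F r * Fintype.card F := fun g hg => by
    rw [← neg_one_mul s, eta_mul, eta_mul]
    linear_combination (eta F s ^ 2 * eta F r * eta F (-1)) * hg
      + eta F r * Fintype.card F * eta F (-1) ^ 2 * eta_sq hs
      + eta F r * Fintype.card F * eta_sq (neg_ne_zero.mpr (one_ne_zero (α := F)))
  rw [hb _ hg, mul_pow]
  congr 1
  · obtain ⟨k, rfl⟩ := hd
    rw [pow_succ (eta F r), pow_mul (eta F r), eta_sq hr, one_pow, one_mul]
  · congr 1
    rw [h4]
    field_simp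
    ring

theorem orth_sum_odd (F : Type) [Field F] [Fintype F] [DecidableEq F]
    (hq : Odd (Fintype.card F)) (d : ℕ) (hd : 3 ≤ d) (hdo : Odd d)
    (χ : AddChar F ℂ) (hχ : χ ≠ 1) (r : F) (hr : r ≠ 0) (m m' : Fin d → F) :
    ∑ t : F, sphereFT d χ t m * sphereFT d χ (r * t) m'
      = if nrm m = r * nrm m' then
          (Fintype.card F : ℂ)⁻¹ * (if m = 0 then 1 else 0) * (if m' = 0 then 1 else 0)
            + ((Fintype.card F : ℂ) ^ (-(d : ℤ)) - (Fintype.card F : ℂ) ^ (-(d : ℤ) - 1))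
              * eta F r
        else
          -(Fintype.card F : ℂ) ^ (-(d : ℤ) - 1) * eta F r := by
  have hF : ringChar F ≠ 2 := fun h => by
    have := FiniteField.even_card_of_char_two h
    grind
  have hq0 : (Fintype.card F : ℂ) ≠ 0 := by simp
  have h4 : (4 : F) ≠ 0 := by
    rw [show (4 : F) = 2 * 2 by norm_num]
    exact mul_ne_zero (Ring.two_ne_zero hF) (Ring.two_ne_zero hF)
  have hinv : ∀ a : F, ∑ s ∈ Finset.univ.erase (0 : F), χ (s⁻¹ * a)
      = (if a = 0 then (Fintype.card F : ℂ) else 0) - 1 := fun a => by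
    have h := Equiv.sum_comp (Equiv.inv F) (fun s => χ (s * a))
    rw [sum_addChar_mul hχ, ← Finset.add_sum_erase _ _ (Finset.mem_univ (0 : F))] at h
    simp only [Equiv.inv_apply, inv_zero, zero_mul, AddChar.map_zero_eq_one] at h
    linear_combination h
  have hz : (r * nrm m' - nrm m) / (4 * r) = 0 ↔ nrm m = r * nrm m' := by
    rw [div_eq_zero_iff, or_iff_left (mul_ne_zero h4 hr), sub_eq_zero, eq_comm]
  rw [sum_sphereFT_mul hχ, ← Finset.add_sum_erase _ _ (Finset.mem_univ (0 : F)),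
    Finset.sum_congr rfl fun s hs =>
      sum_nrm_mul_sum_nrm hF hχ hdo hr (Finset.ne_of_mem_erase hs) m m',
    ← Finset.mul_sum, hinv]
  simp only [hz, zero_mul, neg_zero, zero_sub, sum_addChar_dotProduct hχ]
  rw [zpow_sub₀ hq0, zpow_neg, zpow_natCast, zpow_one]
  by_cases hm : nrm m = r * nrm m'
  · rw [if_pos hm, if_pos hm]
    split_ifs <;> field_simp <;> ring
  · have h0 : ¬(m = 0 ∧ m' = 0) := by
      rintro ⟨rfl, rfl⟩
      simp [nrm] at hm
    rw [if_neg hm, if_neg hm]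
    split_ifs <;> first | (exfalso; tauto) | (field_simp; ring)
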